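/- For all x, y ∈ X and all i, j ∈ Bool, the modified Lindbladian acts on matrix elements as ℒ'(|x⟩⟨y| ⊗ |i⟩⟨j|) = γ · |x⟩⟨y| ⊗ [ δ_{i, ¬C(x)} δ_{j, ¬C(y)} |C(x)⟩⟨C(y)| − (1/2)(δ_{i, ¬C(x)} + δ_{j, ¬C(y)}) |i⟩⟨j| ], where δ denotes the Kronecker delta on Bool. -/

import Mathlib

open Matrix Filter
open scoped Kronecker Topology

attribute [local instance] Matrix.normedAddCommGroup Matrix.normedSpace

noncomputable section

/-- The computational basis of `n` qubits, `X = {0,1}ⁿ`. -/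
abbrev QubitBasis (n : ℕ) := Fin n → Bool

/-- Evaluation of the 3-literal clause with indices `i₁ i₂ i₃` and bits `b₁ b₂ b₃`:
`C(x) = ¬(x i₁ = b₁ ∧ x i₂ = b₂ ∧ x i₃ = b₃)`. -/
def clauseEval {n : ℕ} (i₁ i₂ i₃ : Fin n) (b₁ b₂ b₃ : Bool) (x : QubitBasis n) : Bool :=
  ! (decide (x i₁ = b₁) && decide (x i₂ = b₂) && decide (x i₃ = b₃))

/-- The modified Lindblad operator `L' = Π⁻ ⊗ σ⁻ + (I − Π⁻) ⊗ σ⁺`: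
`L'((x,a),(y,b)) = 1` iff `x = y`, `a = C(x)` and `b = ¬C(x)`. -/
def jumpOp' {n : ℕ} (C : QubitBasis n → Bool) :
    Matrix (QubitBasis n × Bool) (QubitBasis n × Bool) ℂ :=
  Matrix.of fun p q =>
    if p.1 = q.1 ∧ p.2 = C p.1 ∧ q.2 = !C p.1 then 1 else 0

/-- The Lindbladian `ℒ(ρ) = γ (L ρ L† − (1/2)(L†L ρ + ρ L†L))` as a linear endomorphism
of the matrix space. -/
def lindbladian {d : Type*} [Fintype d] [DecidableEq d] (γ : ℝ) (L : Matrix d d ℂ) :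
    Matrix d d ℂ →ₗ[ℂ] Matrix d d ℂ :=
  (γ : ℂ) • ((LinearMap.mulRight ℂ Lᴴ).comp (LinearMap.mulLeft ℂ L)
    - (1 / 2 : ℂ) • (LinearMap.mulLeft ℂ (Lᴴ * L) + LinearMap.mulRight ℂ (Lᴴ * L)))

/-- The evolution `E'_t = exp(t·ℒ')`, the exponential of the endomorphism `ℒ'`. -/
def evol {d : Type*} [Fintype d] [DecidableEq d]
    (L : Matrix d d ℂ →ₗ[ℂ] Matrix d d ℂ) (t : ℝ) :
    Matrix d d ℂ →L[ℂ] Matrix d d ℂ :=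
  haveI : IsTopologicalRing (Matrix d d ℂ →L[ℂ] Matrix d d ℂ) :=
    @NonUnitalSeminormedRing.toIsTopologicalRing _
      (ContinuousLinearMap.toNormedRing (𝕜 := ℂ)
        (E := Matrix d d ℂ)).toSeminormedRing.toNonUnitalSeminormedRing
  NormedSpace.exp ((t : ℂ) • LinearMap.toContinuousLinearMap L)

/-- The Kronecker delta on `Bool`, valued in `ℂ`. -/
def kdelta (i j : Bool) : ℂ := if i = j then 1 else 0

theorem jumpOp'_mul_single {n : ℕ} (C : QubitBasis n → Bool) (x : QubitBasis n) (i : Bool)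
    (q : QubitBasis n × Bool) :
    jumpOp' C * Matrix.single (x, i) q (1 : ℂ)
      = kdelta i (!C x) • Matrix.single (x, C x) q (1 : ℂ) := by
  ext ⟨a, b⟩ r
  by_cases hr : q = r
  · subst hr
    simp only [Matrix.mul_single_apply_same, Matrix.smul_apply, Matrix.single_apply, jumpOp',
      kdelta, Matrix.of_apply, Prod.mk.injEq, smul_eq_mul, mul_one]
    by_cases ha : a = x
    · subst ha
      grind
    · have : ¬ x = a := fun h => ha h.symm
      simp [ha, this]
  · rw [Matrix.mul_single_apply_of_ne _ _ _ _ _ (Ne.symm hr)]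
    simp [Matrix.single_apply, hr]

theorem jumpOp'_conjTranspose_mul_single {n : ℕ} (C : QubitBasis n → Bool) (x : QubitBasis n)
    (i : Bool) (q : QubitBasis n × Bool) :
    (jumpOp' C)ᴴ * Matrix.single (x, i) q (1 : ℂ)
      = kdelta i (C x) • Matrix.single (x, !C x) q (1 : ℂ) := by
  ext ⟨a, b⟩ r
  by_cases hr : q = r
  · subst hr
    simp only [Matrix.mul_single_apply_same, Matrix.smul_apply, Matrix.single_apply, jumpOp',
      kdelta, Matrix.of_apply, Prod.mk.injEq, smul_eq_mul, mul_one, Matrix.conjTranspose_apply,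
      apply_ite (star : ℂ → ℂ), star_one, star_zero]
    by_cases ha : x = a
    · subst ha
      grind
    · simp [ha]
  · rw [Matrix.mul_single_apply_of_ne _ _ _ _ _ (Ne.symm hr)]
    simp [Matrix.single_apply, hr]

theorem star_kdelta (i j : Bool) : star (kdelta i j) = kdelta i j := by
  unfold kdelta; split_ifs <;> simp

theorem jumpOp'_number_mul_single {n : ℕ} (C : QubitBasis n → Bool) (x : QubitBasis n)
    (i : Bool) (q : QubitBasis n × Bool) :
    (jumpOp' C)ᴴ * jumpOp' C * Matrix.single (x, i) q (1 : ℂ)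
      = kdelta i (!C x) • Matrix.single (x, i) q (1 : ℂ) := by
  rw [Matrix.mul_assoc, jumpOp'_mul_single, Matrix.mul_smul, jumpOp'_conjTranspose_mul_single]
  by_cases h : i = !C x
  · subst h; simp [kdelta]
  · simp [kdelta, h]

theorem single_mul_jumpOp'_conjTranspose {n : ℕ} (C : QubitBasis n → Bool) (y : QubitBasis n)
    (j : Bool) (p : QubitBasis n × Bool) :
    Matrix.single p (y, j) (1 : ℂ) * (jumpOp' C)ᴴ
      = kdelta j (!C y) • Matrix.single p (y, C y) (1 : ℂ) := by
  have h := congrArg Matrix.conjTranspose (jumpOp'_mul_single C y j p)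
  simpa only [Matrix.conjTranspose_mul, Matrix.conjTranspose_smul, Matrix.conjTranspose_single,
    star_one, star_kdelta] using h

theorem single_mul_jumpOp'_number {n : ℕ} (C : QubitBasis n → Bool) (y : QubitBasis n)
    (j : Bool) (p : QubitBasis n × Bool) :
    Matrix.single p (y, j) (1 : ℂ) * ((jumpOp' C)ᴴ * jumpOp' C)
      = kdelta j (!C y) • Matrix.single p (y, j) (1 : ℂ) := by
  have h := congrArg Matrix.conjTranspose (jumpOp'_number_mul_single C y j p)
  simpa only [Matrix.conjTranspose_mul, Matrix.conjTranspose_smul, Matrix.conjTranspose_single,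
    Matrix.conjTranspose_conjTranspose, star_one, star_kdelta] using h

/-- action of the modified Lindbladian on matrix elements:
`ℒ'(|x⟩⟨y| ⊗ |i⟩⟨j|) = γ·|x⟩⟨y| ⊗ [δ_{i,¬C(x)} δ_{j,¬C(y)} |C(x)⟩⟨C(y)|
− (1/2)(δ_{i,¬C(x)} + δ_{j,¬C(y)}) |i⟩⟨j|]`. -/
theorem lindbladian'_matrix_unit {n : ℕ} (hn : 1 ≤ n)
    (i₁ i₂ i₃ : Fin n) (h₁₂ : i₁ ≠ i₂) (h₁₃ : i₁ ≠ i₃) (h₂₃ : i₂ ≠ i₃)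
    (b₁ b₂ b₃ : Bool) (γ : ℝ) (hγ : 0 < γ)
    (C : QubitBasis n → Bool) (hC : C = clauseEval i₁ i₂ i₃ b₁ b₂ b₃)
    (x y : QubitBasis n) (i j : Bool) :
    lindbladian γ (jumpOp' C) (Matrix.single (x, i) (y, j) 1)
      = (γ : ℂ) •
          ((kdelta i (!C x) * kdelta j (!C y)) • Matrix.single (x, C x) (y, C y) (1 : ℂ)
            - ((1 / 2 : ℂ) * (kdelta i (!C x) + kdelta j (!C y))) •
                Matrix.single (x, i) (y, j) (1 : ℂ)) := by
  simp only [lindbladian, LinearMap.smul_apply, LinearMap.sub_apply, LinearMap.add_apply,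
    LinearMap.comp_apply, LinearMap.mulLeft_apply, LinearMap.mulRight_apply]
  rw [jumpOp'_number_mul_single, single_mul_jumpOp'_number, jumpOp'_mul_single, Matrix.smul_mul,
    single_mul_jumpOp'_conjTranspose, smul_smul, ← add_smul, smul_smul]
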